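/- There are exactly 16 reflexive polygons up to unimodular equivalence; that is, the set of reflexive polygons in ℝ², modulo the action of GL(2,ℤ), consists of exactly 16 equivalence classes. -/

import Mathlib

/-- The real vector in `ℝⁿ` corresponding to a lattice point of `ℤⁿ`. -/
def castVec {n : ℕ} (v : Fin n → ℤ) : Fin n → ℝ := fun i => (v i : ℝ)

/-- A lattice polytope in `ℝⁿ`: the convex hull of a finite set of points of `ℤⁿ`. -/
def IsLatticePolytope {n : ℕ} (P : Set (Fin n → ℝ)) : Prop :=
  ∃ F : Finset (Fin n → ℤ), P = convexHull ℝ (castVec '' (F : Set (Fin n → ℤ)))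

/-- A reflexive polytope: a lattice polytope with nonempty interior, whose unique
interior lattice point is the origin, and whose dual polytope
`P* = {y : ⟨x,y⟩ ≥ −1 for all x ∈ P}` is again a lattice polytope. -/
def IsReflexivePolytope {n : ℕ} (P : Set (Fin n → ℝ)) : Prop :=
  IsLatticePolytope P ∧ (interior P).Nonempty ∧
  (∀ v : Fin n → ℤ, castVec v ∈ interior P ↔ v = 0) ∧
  IsLatticePolytope {y : Fin n → ℝ | ∀ x ∈ P, (-1 : ℝ) ≤ ∑ i, x i * y i}

/-- Unimodular equivalence of subsets of `ℝⁿ`: some `A ∈ GL(n,ℤ)` maps one onto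
the other. -/
def UnimodularEquiv {n : ℕ} (P Q : Set (Fin n → ℝ)) : Prop :=
  ∃ A : Matrix (Fin n) (Fin n) ℤ, IsUnit A.det ∧
    (fun x => (A.map (fun k : ℤ => (k : ℝ))).mulVec x) '' P = Q

/-- Pairing on `ℤ²`. -/
def pr (s t : ℤ × ℤ) : ℤ := s.1 * t.1 + s.2 * t.2

/-- Determinant on `ℤ²`. -/
def dt (s t : ℤ × ℤ) : ℤ := s.1 * t.2 - s.2 * t.1

/-- A pair of mutually polar sets of lattice points, both positively spanning. -/
structure PolarPair (S T : Set (ℤ × ℤ)) : Prop where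
  hS : ∀ s, s ∈ S ↔ ∀ t ∈ T, -1 ≤ pr s t
  hT : ∀ t, t ∈ T ↔ ∀ s ∈ S, -1 ≤ pr s t
  pS : ∀ t, t ≠ 0 → ∃ s ∈ S, pr s t < 0
  pT : ∀ s, s ≠ 0 → ∃ t ∈ T, pr s t < 0

theorem pr_comb (s u v : ℤ × ℤ) (a b : ℤ) : pr s (a • u + b • v) = a * pr s u + b * pr s v := by
  simp [pr]; ring

theorem comb_mem {S T : Set (ℤ × ℤ)} (h : PolarPair S T) {u v : ℤ × ℤ} {a b : ℤ} (hu : u ∈ T)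
    (ht : a • u + b • v ∈ T) (hb : 1 ≤ b) :
    ∃ k : ℤ, a ≤ k * b ∧ k * b ≤ a + b - 1 ∧ k • u + (1 : ℤ) • v ∈ T := by
  refine ⟨(a + b - 1) / b, ?_, Int.ediv_mul_le _ (by omega), ?_⟩
  · have := Int.lt_ediv_add_one_mul_self (a + b - 1) (by omega : 0 < b)
    linarith
  · have h1 := Int.lt_ediv_add_one_mul_self (a + b - 1) (by omega : 0 < b)
    have h2 := Int.ediv_mul_le (a + b - 1) (by omega : b ≠ 0)
    generalize (a + b - 1) / b = k at *
    rw [h.hT]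
    intro s hs
    have e1 := (h.hT _).1 hu s hs
    have e2 := (h.hT _).1 ht s hs
    rw [pr_comb] at *
    generalize pr s u = x at *
    generalize pr s v = y at *
    have h3 : 0 ≤ k * b - a := by linarith
    have h4 : 0 ≤ (k * b - a) * (x + 1) := mul_nonneg h3 (by linarith)
    by_contra hc
    push Not at hc
    have h5 : k * x + 1 * y + 2 ≤ 0 ∨ k * x + 1 * y + 2 > 0 := le_or_gt _ _
    have h6 : k * x + 1 * y ≤ -2 := by omega
    nlinarith

theorem rep {u v : ℤ × ℤ} (hD : dt u v * dt u v = 1) (t : ℤ × ℤ) :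
    t = (dt u v * dt t v) • u + (dt u v * dt u t) • v := by
  ext
  · simp [dt] at *; linear_combination (-t.1) * hD
  · simp [dt] at *; linear_combination (-t.2) * hD

theorem neg_comb {S T : Set (ℤ × ℤ)} (h : PolarPair S T) {u v : ℤ × ℤ}
    (hD : dt u v * dt u v = 1) (x y : ℤ) (hxy : ¬ (x = 0 ∧ y = 0)) :
    ∃ a b : ℤ, a • u + b • v ∈ T ∧ x * a + y * b < 0 := by
  obtain ⟨t, ht, hlt⟩ := h.pT (dt u v * (x * v.2 - y * u.2), dt u v * (- x * v.1 + y * u.1)) (by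
    intro h0
    rw [Prod.ext_iff] at h0
    obtain ⟨h1, h2⟩ := h0
    simp only [Prod.fst_zero, Prod.snd_zero] at h1 h2
    apply hxy
    simp only [dt] at *
    constructor
    · linear_combination (-x) * hD + u.1 * h1 + u.2 * h2
    · linear_combination (-y) * hD + v.1 * h1 + v.2 * h2)
  refine ⟨dt u v * dt t v, dt u v * dt u t, ?_, ?_⟩
  · rw [← rep hD]; exact ht
  · simp only [pr, dt] at *
    linarith

theorem c_bound {S T : Set (ℤ × ℤ)} (h : PolarPair S T) {u v : ℤ × ℤ} (hD : dt u v * dt u v = 1)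
    (hu : u ∈ T) (hv : v ∈ T) {c : ℤ} (hc : c • u + (-1 : ℤ) • v ∈ T) : -2 ≤ c ∧ c ≤ 2 := by
  have hu0 : u ≠ 0 := by rintro rfl; simp [dt] at hD
  obtain ⟨s, hs, hsu⟩ := h.pS u hu0
  obtain ⟨s', hs', hsu'⟩ := h.pS (-u) (by simpa using hu0)
  have a1 := (h.hT _).1 hu s hs
  have a2 := (h.hT _).1 hv s hs
  have a3 := (h.hT _).1 hc s hs
  have b2 := (h.hT _).1 hv s' hs'
  have b3 := (h.hT _).1 hc s' hs'
  have b1 : 1 ≤ pr s' u := by simp [pr] at *; linarith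
  rw [pr_comb] at a3 b3
  have : pr s u = -1 := by omega
  rw [this] at a3
  constructor
  · by_contra hh
    push Not at hh
    nlinarith
  · linarith

theorem exists_c {S T : Set (ℤ × ℤ)} (h : PolarPair S T) {u v : ℤ × ℤ}
    (hD : dt u v * dt u v = 1) (hu : u ∈ T) (hv : v ∈ T) :
    ∃ c : ℤ, -2 ≤ c ∧ c ≤ 2 ∧ c • u + (-1 : ℤ) • v ∈ T := by
  obtain ⟨a, b, ht, hlt⟩ := neg_comb h hD 0 1 (by simp)
  obtain ⟨k, h1, h2, hk⟩ := comb_mem h (v := -v) (a := a) (b := -b) hu (by simpa using ht) (by omega)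
  have hk' : k • u + (-1 : ℤ) • v ∈ T := by simpa using hk
  obtain ⟨x, y⟩ := c_bound h hD hu hv hk'
  exact ⟨k, x, y, by simpa using hk⟩

/-- `T` contains one of the three minimal configurations. -/
def Good (T : Set (ℤ × ℤ)) : Prop :=
  ∃ u ∈ T, ∃ v ∈ T, dt u v * dt u v = 1 ∧
    ((-1 : ℤ) • u + (-1 : ℤ) • v ∈ T ∨ (-u ∈ T ∧ -v ∈ T) ∨ (-2 : ℤ) • u + (-1 : ℤ) • v ∈ T)

theorem good_of_neg {S T : Set (ℤ × ℤ)} (h : PolarPair S T) {u v : ℤ × ℤ}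
    (hD : dt u v * dt u v = 1) (hu : u ∈ T) (hv : v ∈ T) (hu' : -u ∈ T) : Good T := by
  have hD' : dt (-u) v * dt (-u) v = 1 := by simp [dt] at *; linarith
  obtain ⟨c, h1, h2, hc⟩ := exists_c h hD hu hv
  have : c = -2 ∨ c = -1 ∨ c = 0 ∨ c = 1 ∨ c = 2 := by omega
  rcases this with rfl | rfl | rfl | rfl | rfl
  · exact ⟨u, hu, v, hv, hD, Or.inr (Or.inr hc)⟩
  · exact ⟨u, hu, v, hv, hD, Or.inl hc⟩
  · exact ⟨u, hu, v, hv, hD, Or.inr (Or.inl ⟨hu', by simpa using hc⟩)⟩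
  · exact ⟨-u, hu', v, hv, hD', Or.inl (by simpa using hc)⟩
  · exact ⟨-u, hu', v, hv, hD', Or.inr (Or.inr (by simpa using hc))⟩

theorem dt_swap {u v : ℤ × ℤ} (hD : dt u v * dt u v = 1) : dt v u * dt v u = 1 := by
  simp [dt] at *; linarith

/-- Negative coefficient case. -/
theorem good_of_nonpos {S T : Set (ℤ × ℤ)} (h : PolarPair S T) {u v : ℤ × ℤ}
    (hD : dt u v * dt u v = 1) (hu : u ∈ T) (hv : v ∈ T) {c : ℤ}
    (hc : c • u + (-1 : ℤ) • v ∈ T) (hc0 : c ≤ 0) : Good T := by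
  have h1 := (c_bound h hD hu hv hc).1
  have : c = -2 ∨ c = -1 ∨ c = 0 := by omega
  rcases this with rfl | rfl | rfl
  · exact ⟨u, hu, v, hv, hD, Or.inr (Or.inr hc)⟩
  · exact ⟨u, hu, v, hv, hD, Or.inl hc⟩
  · exact good_of_neg h (dt_swap hD) hv hu (by simpa using hc)

theorem good_aux {S T : Set (ℤ × ℤ)} (h : PolarPair S T) {u v : ℤ × ℤ}
    (hD : dt u v * dt u v = 1) (hu : u ∈ T) (hv : v ∈ T) {a b : ℤ}
    (ht : a • u + b • v ∈ T) (hab : a + b < 0) (ha : a < 0) : Good T := by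
  have hD' := dt_swap hD
  obtain ⟨k, h1, h2, hk⟩ := comb_mem h (u := v) (v := -u) (a := b) (b := -a) hv
    (by convert ht using 1; module) (by omega)
  have hk' : k • v + (-1 : ℤ) • u ∈ T := by simpa using hk
  by_cases hk0 : k ≤ 0
  · exact good_of_nonpos h hD' hv hu hk' hk0
  have hb : 0 < b := by
    by_contra hb
    have : k * (-a) < 1 * (-a) := by linarith
    have := lt_of_mul_lt_mul_right this (by omega)
    omega
  have hk1 : k = 1 := by
    have : k * (-a) < 2 * (-a) := by linarith
    have := lt_of_mul_lt_mul_right this (by omega)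
    omega
  subst hk1
  obtain ⟨c, c1, c2, hc⟩ := exists_c h hD hu hv
  by_cases hc0 : c ≤ 0
  · exact good_of_nonpos h hD hu hv hc hc0
  have hvu : v - u ∈ T := by convert hk' using 1; module
  obtain ⟨m, m1, m2, hm⟩ := comb_mem h (u := v - u) (v := -u) (a := b) (b := -a - b) hvu
    (by convert ht using 1; module) (by omega)
  have hD2 : dt (v - u) v * dt (v - u) v = 1 := by
    simp [dt] at *; linarith
  have hm2 : (m + 1) • (v - u) + (-1 : ℤ) • v ∈ T := by convert hm using 1; module
  have hmb := c_bound h hD2 hvu hv hm2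
  have hm0 : 0 < m := by
    by_contra hh
    have : m * (-a - b) ≤ 0 := mul_nonpos_of_nonpos_of_nonneg (by omega) (by omega)
    omega
  have hm1 : m = 1 := by omega
  subst hm1
  have : c = 1 ∨ c = 2 := by omega
  rcases this with rfl | rfl
  · exact good_of_neg h hD2 hvu hv (by convert hc using 1; module)
  · refine good_of_neg h (u := (2 : ℤ) • u + (-1 : ℤ) • v) (v := u) ?_ hc hu ?_
    · simp [dt] at *; linarith
    · convert hm using 1; module

theorem good_of_basis {S T : Set (ℤ × ℤ)} (h : PolarPair S T) {u v : ℤ × ℤ}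
    (hD : dt u v * dt u v = 1) (hu : u ∈ T) (hv : v ∈ T) : Good T := by
  obtain ⟨a, b, ht, hlt⟩ := neg_comb h hD 1 1 (by simp)
  by_cases ha : a < 0
  · exact good_aux h hD hu hv ht (by omega) ha
  · exact good_aux h (dt_swap hD) hv hu (a := b) (b := a) (by rwa [add_comm]) (by omega) (by omega)

theorem good {S T : Set (ℤ × ℤ)} (h : PolarPair S T) : Good T := by
  obtain ⟨u, hu, hlt⟩ := h.pT (1, 0) (by simp)
  have hu0 : u ≠ 0 := by rintro rfl; simp [pr] at hlt
  obtain ⟨s, hs, hsu⟩ := h.pS u hu0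
  have h1 := (h.hT _).1 hu s hs
  have h2 : pr s u = -1 := by omega
  have hD : dt u (s.2, -s.1) * dt u (s.2, -s.1) = 1 := by
    have : dt u (s.2, -s.1) = 1 := by simp [dt, pr] at *; linarith
    rw [this]; rfl
  obtain ⟨a, b, ht, hb⟩ := neg_comb h hD 0 (-1) (by simp)
  obtain ⟨k, _, _, hk⟩ := comb_mem h hu ht (by omega)
  refine good_of_basis h ?_ hu hk
  simp [dt] at *
  linarith

/-- The 16 polygons (boundary lattice points in cyclic order) with their duals. -/
def polys : List (List (ℤ × ℤ) × List (ℤ × ℤ)) := [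
  ([(0, -1), (1, -1), (-1, 2)],
    [(-2, -1), (-3, -2), (-1, -1), (1, 0), (3, 1), (2, 1), (1, 1), (0, 1), (-1, 0)]),
  ([(1, -1), (-1, 2), (-1, 1), (-1, 0)],
    [(-2, -1), (-3, -2), (-1, -1), (1, 0), (1, 1), (1, 2), (0, 1), (-1, 0)]),
  ([(0, -1), (1, -1), (-1, 2), (-1, 1)],
    [(-2, -1), (-3, -2), (-1, -1), (1, 0), (2, 1), (1, 1), (0, 1), (-1, 0)]),
  ([(0, -1), (1, -1), (0, 1), (-1, 1)],
    [(-2, -1), (-1, -1), (0, -1), (1, 0), (2, 1), (1, 1), (0, 1), (-1, 0)]),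
  ([(0, -1), (1, -1), (-1, 2), (-1, 1), (-1, 0)],
    [(-2, -1), (-3, -2), (-1, -1), (1, 0), (1, 1), (0, 1), (-1, 0)]),
  ([(0, -1), (1, -1), (0, 1), (-1, 1), (-1, 0)],
    [(-2, -1), (-1, -1), (0, -1), (1, 0), (1, 1), (0, 1), (-1, 0)]),
  ([(-1, -1), (0, -1), (1, -1), (-1, 2), (-1, 1), (-1, 0)],
    [(-2, -1), (-3, -2), (-1, -1), (1, 0), (0, 1), (-1, 0)]),
  ([(-1, -1), (0, -1), (1, -1), (0, 1), (-1, 1), (-1, 0)],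
    [(-2, -1), (-1, -1), (0, -1), (1, 0), (0, 1), (-1, 0)]),
  ([(0, -1), (1, -1), (0, 1), (-1, 2), (-1, 1), (-1, 0)],
    [(-2, -1), (-1, -1), (1, 0), (1, 1), (0, 1), (-1, 0)]),
  ([(0, -1), (1, -1), (1, 0), (0, 1), (-1, 1), (-1, 0)],
    [(-1, -1), (0, -1), (1, 0), (1, 1), (0, 1), (-1, 0)]),
  ([(-1, -1), (0, -1), (1, -1), (0, 1), (-1, 2), (-1, 1), (-1, 0)],
    [(-2, -1), (-1, -1), (1, 0), (0, 1), (-1, 0)]),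
  ([(-1, -1), (0, -1), (1, -1), (1, 0), (0, 1), (-1, 1), (-1, 0)],
    [(-1, -1), (0, -1), (1, 0), (0, 1), (-1, 0)]),
  ([(-1, -1), (0, -1), (1, -1), (1, 0), (0, 1), (-1, 2), (-1, 1), (-1, 0)],
    [(-1, -1), (1, 0), (0, 1), (-1, 0)]),
  ([(-1, -1), (0, -1), (1, -1), (1, 0), (1, 1), (0, 1), (-1, 1), (-1, 0)],
    [(0, -1), (1, 0), (0, 1), (-1, 0)]),
  ([(-1, -1), (0, -1), (1, -1), (0, 1), (-1, 3), (-1, 2), (-1, 1), (-1, 0)],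
    [(-2, -1), (1, 0), (0, 1), (-1, 0)]),
  ([(-1, -1), (0, -1), (1, -1), (2, -1), (1, 0), (0, 1), (-1, 2), (-1, 1), (-1, 0)],
    [(-1, -1), (1, 0), (0, 1)])]

/-- Unimodular matrices used for normalisation. -/
def mats : List (ℤ × ℤ × ℤ × ℤ) := [
  (1, 0, 0, 1),
  (0, 1, -1, -1),
  (0, 1, 1, 0),
  (-1, 0, 1, -1),
  (1, 0, -1, -1),
  (-1, -1, 0, 1),
  (0, 1, 1, -1),
  (-1, -1, 1, 0),
  (0, -1, -1, 1),
  (1, 0, -2, -1),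
  (-1, 0, 1, 1),
  (0, -1, -1, 0),
  (-1, 0, 0, 1),
  (1, 0, -1, 1),
  (0, -1, 1, 1),
  (0, -1, 1, 0),
  (-1, 0, 0, -1),
  (0, -1, 1, 2),
  (-1, 0, 2, 1),
  (0, 1, -1, -2),
  (1, 0, 0, -1),
  (0, 1, -1, 0),
  (0, 1, 1, -2),
  (-1, 0, 2, -1),
  (-2, -1, 1, 1),
  (-1, -1, 2, 1),
  (-1, -1, 1, 2),
  (-2, -1, 3, 1)]

/-- Maximal polygon. -/
def maxi1 : List (ℤ × ℤ) := [(0, 0), (-1, -1), (-1, 0), (-1, 1), (-1, 2), (0, -1), (0, 1), (1, -1), (1, 0), (2, -1)]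

/-- Maximal polygon. -/
def maxi2 : List (ℤ × ℤ) := [(0, 0), (-1, -1), (-1, 0), (-1, 1), (0, -1), (0, 1), (1, -1), (1, 0), (1, 1)]

/-- Maximal polygon. -/
def maxi3 : List (ℤ × ℤ) := [(0, 0), (-1, -1), (-1, 0), (-1, 1), (-1, 2), (-1, 3), (0, -1), (0, 1), (1, -1)]

/-- All sublists. -/
def subs : List (ℤ × ℤ) → List (List (ℤ × ℤ))
  | [] => [[]]
  | a :: l => subs l ++ (subs l).map (fun x => a :: x)

theorem filter_mem_subs (p : ℤ × ℤ → Bool) (l : List (ℤ × ℤ)) : l.filter p ∈ subs l := by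
  induction l with
  | nil => simp [subs]
  | cons a l ih =>
    by_cases h : p a = true
    · simp [subs, h, ih]
    · simp [subs, h, ih]

/-- Action of a matrix. -/
def ap (g : ℤ × ℤ × ℤ × ℤ) (p : ℤ × ℤ) : ℤ × ℤ :=
  (g.1 * p.1 + g.2.1 * p.2, g.2.2.1 * p.1 + g.2.2.2 * p.2)

/-- Determinant of a matrix. -/
def gdet (g : ℤ × ℤ × ℤ × ℤ) : ℤ := g.1 * g.2.2.2 - g.2.1 * g.2.2.1

/-- Product of matrices. -/
def gmul (g h : ℤ × ℤ × ℤ × ℤ) : ℤ × ℤ × ℤ × ℤ :=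
  (g.1 * h.1 + g.2.1 * h.2.2.1, g.1 * h.2.1 + g.2.1 * h.2.2.2,
   g.2.2.1 * h.1 + g.2.2.2 * h.2.2.1, g.2.2.1 * h.2.1 + g.2.2.2 * h.2.2.2)

theorem ap_gmul (g h : ℤ × ℤ × ℤ × ℤ) (p : ℤ × ℤ) : ap (gmul g h) p = ap g (ap h p) := by
  ext <;> simp [ap, gmul] <;> ring

theorem gdet_gmul (g h : ℤ × ℤ × ℤ × ℤ) : gdet (gmul g h) = gdet g * gdet h := by
  simp [gdet, gmul]; ring

/-- Small nonzero functionals. -/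
def box : List (ℤ × ℤ) := [(1, 0), (-1, 0), (0, 1), (0, -1), (1, 1), (1, -1), (-1, 1), (-1, -1)]

/-- Necessary conditions on the lattice points of a reflexive polygon. -/
def okB (X : List (ℤ × ℤ)) : Bool :=
  X.contains (0, 0) && box.all (fun t => X.any (fun s => decide (pr s t < 0))) &&
  X.all (fun p => X.all (fun q =>
    (decide ((p.1 + q.1) % 2 ≠ 0) || decide ((p.2 + q.2) % 2 ≠ 0) ||
      X.contains ((p.1 + q.1) / 2, (p.2 + q.2) / 2)) &&
    (decide ((p.1 + 2 * q.1) % 3 ≠ 0) || decide ((p.2 + 2 * q.2) % 3 ≠ 0) ||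
      X.contains ((p.1 + 2 * q.1) / 3, (p.2 + 2 * q.2) / 3))))

/-- `X` is equivalent to a listed polygon. -/
def foundB (X : List (ℤ × ℤ)) : Bool :=
  polys.any (fun L => (L.1.length + 1 == X.length) && mats.any (fun g =>
    X.all (fun x => ((0, 0) :: L.1).contains (ap g x)) &&
    ((0, 0) :: L.1).all (fun y => X.any (fun x => ap g x == y))))

theorem check1 : (subs maxi1).all (fun X => !okB X || foundB X) = true := by decide +kernel
theorem check2 : (subs maxi2).all (fun X => !okB X || foundB X) = true := by decide +kernel
theorem check3 : (subs maxi3).all (fun X => !okB X || foundB X) = true := by decide +kernel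

theorem mats_det : ∀ g ∈ mats, gdet g * gdet g = 1 := by decide +kernel

theorem found_spec {M : List (ℤ × ℤ)}
    (hM : (subs M).all (fun X => !okB X || foundB X) = true) {S : Set (ℤ × ℤ)}
    (hSM : ∀ s ∈ S, s ∈ M) (h0 : (0 : ℤ × ℤ) ∈ S) (hneg : ∀ t, t ≠ 0 → ∃ s ∈ S, pr s t < 0)
    (h2 : ∀ p ∈ S, ∀ q ∈ S, ∀ x, p + q = (2 : ℤ) • x → x ∈ S)
    (h3 : ∀ p ∈ S, ∀ q ∈ S, ∀ x, p + (2 : ℤ) • q = (3 : ℤ) • x → x ∈ S) :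
    ∃ g, gdet g * gdet g = 1 ∧ ∃ L ∈ polys, ap g '' S = {p | p ∈ (0, 0) :: L.1} := by
  classical
  have hmem : ∀ s, s ∈ M.filter (fun p => decide (p ∈ S)) ↔ s ∈ S := by
    intro s
    simp only [List.mem_filter, decide_eq_true_eq]
    exact ⟨fun h => h.2, fun h => ⟨hSM s h, h⟩⟩
  have hX := List.all_eq_true.1 hM _ (filter_mem_subs (fun p => decide (p ∈ S)) M)
  generalize M.filter (fun p => decide (p ∈ S)) = X at *
  have hok : okB X = true := by
    simp only [okB, Bool.and_eq_true, List.all_eq_true, List.any_eq_true, decide_eq_true_eq,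
      List.contains_iff_mem, Bool.or_eq_true, hmem]
    refine ⟨⟨h0, ?_⟩, ?_⟩
    · intro t ht
      obtain ⟨s, hs, hlt⟩ := hneg t (by rintro rfl; revert ht; decide)
      exact ⟨s, hs, hlt⟩
    · intro p hp q hq
      constructor
      · by_cases e1 : (p.1 + q.1) % 2 = 0
        · by_cases e2 : (p.2 + q.2) % 2 = 0
          · right
            refine h2 p hp q hq _ ?_
            ext <;> simp <;> omega
          · exact Or.inl (Or.inr e2)
        · exact Or.inl (Or.inl e1)
      · by_cases e1 : (p.1 + 2 * q.1) % 3 = 0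
        · by_cases e2 : (p.2 + 2 * q.2) % 3 = 0
          · right
            refine h3 p hp q hq _ ?_
            ext <;> simp <;> omega
          · exact Or.inl (Or.inr e2)
        · exact Or.inl (Or.inl e1)
  rw [hok] at hX
  simp only [Bool.not_true, Bool.false_or, foundB, List.any_eq_true, Bool.and_eq_true,
    List.all_eq_true, List.contains_iff_mem, beq_iff_eq] at hX
  obtain ⟨L, hL, -, g, hg, ha, hb⟩ := hX
  refine ⟨g, mats_det g hg, L, hL, ?_⟩
  ext y
  constructor
  · rintro ⟨x, hx, rfl⟩
    exact ha x ((hmem x).2 hx)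
  · intro hy
    obtain ⟨x, hx, rfl⟩ := hb y hy
    exact ⟨x, (hmem x).1 hx, rfl⟩

theorem mem_maxi1 (s : ℤ × ℤ) (h1 : -1 ≤ s.1) (h2 : -1 ≤ s.2) (h3 : s.1 + s.2 ≤ 1) :
    s ∈ maxi1 := by
  obtain ⟨x, y⟩ := s
  simp only at *
  have : x ≤ 2 := by omega
  have : y ≤ 2 := by omega
  interval_cases x <;> interval_cases y <;> first | omega | decide

theorem mem_maxi2 (s : ℤ × ℤ) (h1 : -1 ≤ s.1) (h2 : -1 ≤ s.2) (h3 : s.1 ≤ 1) (h4 : s.2 ≤ 1) :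
    s ∈ maxi2 := by
  obtain ⟨x, y⟩ := s
  simp only at *
  interval_cases x <;> interval_cases y <;> decide

theorem mem_maxi3 (s : ℤ × ℤ) (h1 : -1 ≤ s.1) (h2 : -1 ≤ s.2) (h3 : 2 * s.1 + s.2 ≤ 1) :
    s ∈ maxi3 := by
  obtain ⟨x, y⟩ := s
  simp only at *
  have : x ≤ 1 := by omega
  have : y ≤ 3 := by omega
  interval_cases x <;> interval_cases y <;> first | omega | decide

theorem classify {S T : Set (ℤ × ℤ)} (h : PolarPair S T) :
    ∃ g, gdet g * gdet g = 1 ∧ ∃ L ∈ polys, ap g '' S = {p | p ∈ (0, 0) :: L.1} := by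
  obtain ⟨u, hu, v, hv, hD, hgood⟩ := good h
  set φ : ℤ × ℤ × ℤ × ℤ := (u.1, u.2, v.1, v.2) with hφ
  have hφd : gdet φ * gdet φ = 1 := hD
  have hφ1 : ∀ s, ap φ s = (pr s u, pr s v) := by
    intro s; ext <;> simp [ap, φ, pr] <;> ring
  have hinj : ∀ x y, ap φ x = ap φ y → x = y := by
    intro x y hxy
    simp only [ap, φ, Prod.mk.injEq] at hxy
    obtain ⟨e1, e2⟩ := hxy
    simp only [dt] at hD
    ext
    · linear_combination (-(x.1 - y.1)) * hD +
        (u.1 * v.2 - u.2 * v.1) * (v.2 * e1 - u.2 * e2)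
    · linear_combination (-(x.2 - y.2)) * hD +
        (u.1 * v.2 - u.2 * v.1) * (u.1 * e2 - v.1 * e1)
  have hsurj : ∀ y, ∃ x, ap φ x = y := by
    intro y
    refine ⟨(dt u v * (v.2 * y.1 - u.2 * y.2), dt u v * (u.1 * y.2 - v.1 * y.1)), ?_⟩
    simp only [dt, ap, φ] at *
    ext
    · simp only; linear_combination y.1 * hD
    · simp only; linear_combination y.2 * hD
  have hadd : ∀ (x y : ℤ × ℤ) (a b : ℤ), ap φ (a • x + b • y) = a • ap φ x + b • ap φ y := by
    intro x y a b
    ext <;> simp [ap] <;> ring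
  have hconv : ∀ p ∈ S, ∀ q ∈ S, ∀ x, ∀ a b : ℤ, 0 < a → 0 < b →
      a • p + b • q = (a + b) • x → x ∈ S := by
    intro p hp q hq x a b ha hb hx
    rw [h.hS]
    intro t ht
    have e1 := (h.hS _).1 hp t ht
    have e2 := (h.hS _).1 hq t ht
    have e3 : a * pr p t + b * pr q t = (a + b) * pr x t := by
      have c1 := congrArg Prod.fst hx
      have c2 := congrArg Prod.snd hx
      simp [pr] at *
      linear_combination t.1 * c1 + t.2 * c2
    by_contra hc
    nlinarith
  have key : ∀ (M : List (ℤ × ℤ)), (subs M).all (fun X => !okB X || foundB X) = true →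
      (∀ s ∈ S, ap φ s ∈ M) →
      ∃ g, gdet g * gdet g = 1 ∧ ∃ L ∈ polys, ap g '' S = {p | p ∈ (0, 0) :: L.1} := by
    intro M hM hSM
    obtain ⟨g, hg, L, hL, himg⟩ := found_spec hM (S := ap φ '' S)
      (by rintro _ ⟨s, hs, rfl⟩; exact hSM s hs)
      ⟨0, (h.hS 0).2 (by intro t _; simp [pr]), by simp [ap]⟩
      (by
        intro t ht
        obtain ⟨s, hs, hlt⟩ := h.pS (t.1 • u + t.2 • v) (by
          intro h0
          apply ht
          have c1 := congrArg Prod.fst h0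
          have c2 := congrArg Prod.snd h0
          simp [dt] at *
          ext
          · simp only [Prod.fst_zero]
            linear_combination (-t.1) * hD + (u.1 * v.2 - u.2 * v.1) * (v.2 * c1 - v.1 * c2)
          · simp only [Prod.snd_zero]
            linear_combination (-t.2) * hD + (u.1 * v.2 - u.2 * v.1) * (u.1 * c2 - u.2 * c1))
        refine ⟨ap φ s, ⟨s, hs, rfl⟩, ?_⟩
        rw [hφ1]
        rw [pr_comb] at hlt
        simp only [pr] at *
        linarith)
      (by
        rintro _ ⟨p, hp, rfl⟩ _ ⟨q, hq, rfl⟩ x hx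
        obtain ⟨z, rfl⟩ := hsurj x
        refine ⟨z, hconv p hp q hq z 1 1 (by norm_num) (by norm_num) (hinj _ _ ?_), rfl⟩
        have := hadd p q 1 1
        have h4 := hadd z 0 (1 + 1) 0
        simp only [zero_smul, add_zero] at h4
        rw [this, h4]
        simpa using hx)
      (by
        rintro _ ⟨p, hp, rfl⟩ _ ⟨q, hq, rfl⟩ x hx
        obtain ⟨z, rfl⟩ := hsurj x
        refine ⟨z, hconv p hp q hq z 1 2 (by norm_num) (by norm_num) (hinj _ _ ?_), rfl⟩
        have := hadd p q 1 2
        have h4 := hadd z 0 (1 + 2) 0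
        simp only [zero_smul, add_zero] at h4
        rw [this, h4]
        simpa using hx)
    refine ⟨gmul g φ, ?_, L, hL, ?_⟩
    · rw [gdet_gmul]; linear_combination hg + gdet g * gdet g * hφd
    · rw [← himg, Set.image_image]
      simp only [ap_gmul]
  have b1 : ∀ s ∈ S, -1 ≤ pr s u := fun s hs => (h.hT _).1 hu s hs
  have b2 : ∀ s ∈ S, -1 ≤ pr s v := fun s hs => (h.hT _).1 hv s hs
  rcases hgood with hw | ⟨hu', hv'⟩ | hw
  · refine key maxi1 check1 fun s hs => ?_
    rw [hφ1]
    have := (h.hT _).1 hw s hs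
    rw [pr_comb] at this
    exact mem_maxi1 _ (b1 s hs) (b2 s hs) (by simp only; linarith)
  · refine key maxi2 check2 fun s hs => ?_
    rw [hφ1]
    have c1 := (h.hT _).1 hu' s hs
    have c2 := (h.hT _).1 hv' s hs
    have d1 : pr s (-u) = - pr s u := by simp [pr]; ring
    have d2 : pr s (-v) = - pr s v := by simp [pr]; ring
    exact mem_maxi2 _ (b1 s hs) (b2 s hs) (by simp only; linarith) (by simp only; linarith)
  · refine key maxi3 check3 fun s hs => ?_
    rw [hφ1]
    have := (h.hT _).1 hw s hs
    rw [pr_comb] at this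
    exact mem_maxi3 _ (b1 s hs) (b2 s hs) (by simp only; linarith)
/-- The `i`-th entry, cyclically. -/
def nth (L : List (ℤ × ℤ)) (i : ℕ) : ℤ × ℤ := L.getD (i % L.length) 0

/-- Certificate that `L` is a cyclic list of boundary points with facet normals in `W`. -/
def Half (L W : List (ℤ × ℤ)) : Prop :=
  0 < L.length ∧
  (∀ p ∈ L, ∀ w ∈ W, -1 ≤ pr p w) ∧
  (∀ i < L.length, dt (nth L i) (nth L (i + 1)) = 1 ∧
    ∃ w ∈ W, pr (nth L i) w = -1 ∧ pr (nth L (i + 1)) w = -1) ∧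
  (∀ g ∈ [((1 : ℤ), (0 : ℤ)), (-1, 0), (0, 1), (0, -1)], ∃ i < L.length,
    0 ≤ dt (nth L i) g ∧ 0 ≤ dt g (nth L (i + 1)))

instance (L W : List (ℤ × ℤ)) : Decidable (Half L W) := by unfold Half; infer_instance

theorem polys_half : ∀ L ∈ polys, Half L.1 L.2 ∧ Half L.2 L.1 := by decide +kernel

theorem nth_mod (L : List (ℤ × ℤ)) (i : ℕ) : nth L (i % L.length) = nth L i := by
  simp [nth]

theorem nth_succ_mod (L : List (ℤ × ℤ)) (i : ℕ) : nth L (i % L.length + 1) = nth L (i + 1) := by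
  simp [nth]

theorem nth_mem {L : List (ℤ × ℤ)} (h : 0 < L.length) (i : ℕ) : nth L i ∈ L := by
  have := Nat.mod_lt i h
  rw [nth, List.getD_eq_getElem _ _ this]
  exact List.getElem_mem _

theorem exists_cone {L W : List (ℤ × ℤ)} (h : Half L W) (x y : ℝ) :
    ∃ i < L.length, 0 ≤ ((nth L i).1 : ℝ) * y - (nth L i).2 * x ∧
      0 ≤ x * (nth L (i + 1)).2 - y * (nth L (i + 1)).1 := by
  obtain ⟨hn, -, hd, hg⟩ := h
  set f : ℤ × ℤ → ℝ := fun p => (p.1 : ℝ) * y - p.2 * x with hf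
  by_contra hc
  push Not at hc
  have step : ∀ i, 0 ≤ f (nth L i) → 0 < f (nth L (i + 1)) := by
    intro i hi
    have := hc (i % L.length) (Nat.mod_lt i hn)
    rw [nth_mod, nth_succ_mod] at this
    have := this hi
    simp only [hf]
    linarith
  have lin : ∀ i < L.length, ∀ g : ℤ × ℤ,
      f g = (dt g (nth L (i + 1)) : ℝ) * f (nth L i) + (dt (nth L i) g : ℝ) * f (nth L (i + 1)) := by
    intro i hi g
    have h1 := (hd i hi).1
    have h2 : ((nth L i).1 : ℝ) * (nth L (i + 1)).2 - (nth L i).2 * (nth L (i + 1)).1 = 1 := by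
      have := congrArg (Int.cast : ℤ → ℝ) h1
      simpa [dt] using this
    simp only [hf, dt]
    push_cast
    linear_combination (-(g.1 : ℝ) * y + g.2 * x) * h2
  by_cases hex : ∃ i, 0 ≤ f (nth L i)
  · obtain ⟨i, hi⟩ := hex
    have hge : ∀ k, 0 ≤ f (nth L (i + k)) := by
      intro k
      induction k with
      | zero => exact hi
      | succ k ih => exact (step _ ih).le
    have hall : ∀ j, 0 ≤ f (nth L j) := by
      intro j
      have h1 := hge (j + i * L.length - i)
      have h2 : i ≤ i * L.length := Nat.le_mul_of_pos_right i hn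
      have h3 : i + (j + i * L.length - i) = j + i * L.length := by omega
      rw [h3, ← nth_mod, Nat.add_mul_mod_self_right, nth_mod] at h1
      exact h1
    have hgg : ∀ g ∈ [((1 : ℤ), (0 : ℤ)), (-1, 0), (0, 1), (0, -1)], 0 ≤ f g := by
      intro g hgm
      obtain ⟨j, hj, a1, a2⟩ := hg g hgm
      rw [lin j hj g]
      have b1 : (0 : ℝ) ≤ dt (nth L j) g := by exact_mod_cast a1
      have b2 : (0 : ℝ) ≤ dt g (nth L (j + 1)) := by exact_mod_cast a2
      have := hall j
      have := hall (j + 1)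
      positivity
    have e1 := hgg (1, 0) (by decide)
    have e2 := hgg (-1, 0) (by decide)
    have e3 := hgg (0, 1) (by decide)
    have e4 := hgg (0, -1) (by decide)
    have e5 := step 0 (hall 0)
    simp [hf] at e1 e2 e3 e4 e5
    have hy : y = 0 := by linarith
    have hx : x = 0 := by linarith
    simp [hx, hy] at e5
  · push Not at hex
    have hgg : ∀ g ∈ [((1 : ℤ), (0 : ℤ)), (-1, 0), (0, 1), (0, -1)], f g ≤ 0 := by
      intro g hgm
      obtain ⟨j, hj, a1, a2⟩ := hg g hgm
      rw [lin j hj g]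
      have b1 : (0 : ℝ) ≤ dt (nth L j) g := by exact_mod_cast a1
      have b2 : (0 : ℝ) ≤ dt g (nth L (j + 1)) := by exact_mod_cast a2
      have := hex j
      have := hex (j + 1)
      nlinarith
    have e1 := hgg (1, 0) (by decide)
    have e2 := hgg (-1, 0) (by decide)
    have e3 := hgg (0, 1) (by decide)
    have e4 := hgg (0, -1) (by decide)
    have e5 := hex 0
    simp [hf] at e1 e2 e3 e4 e5
    have hy : y = 0 := by linarith
    have hx : x = 0 := by linarith
    simp [hx, hy] at e5

/-- The lattice vector of a pair. -/
def zvec (p : ℤ × ℤ) : Fin 2 → ℤ := ![p.1, p.2]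

/-- The real vector of a pair. -/
def vec (p : ℤ × ℤ) : Fin 2 → ℝ := castVec (zvec p)

@[simp] theorem vec_zero (p : ℤ × ℤ) : vec p 0 = p.1 := rfl
@[simp] theorem vec_one (p : ℤ × ℤ) : vec p 1 = p.2 := rfl

theorem zvec_surj (v : Fin 2 → ℤ) : zvec (v 0, v 1) = v := by
  ext i; fin_cases i <;> rfl

/-- Lattice points of a set. -/
def lat (P : Set (Fin 2 → ℝ)) : Set (ℤ × ℤ) := {p | vec p ∈ P}

/-- The polygon of a list. -/
def hull (L : List (ℤ × ℤ)) : Set (Fin 2 → ℝ) := convexHull ℝ (vec '' {p | p ∈ (0, 0) :: L})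

theorem hull_lattice (L : List (ℤ × ℤ)) : IsLatticePolytope (hull L) := by
  classical
  refine ⟨(((0, 0) :: L).map zvec).toFinset, ?_⟩
  unfold hull
  congr 1
  ext x
  simp only [Set.mem_image, Set.mem_ofPred_eq, List.coe_toFinset, List.mem_map]
  constructor
  · rintro ⟨p, hp, rfl⟩
    exact ⟨zvec p, ⟨p, hp, rfl⟩, rfl⟩
  · rintro ⟨_, ⟨p, hp, rfl⟩, rfl⟩
    exact ⟨p, hp, rfl⟩

theorem halfspace_hull {A : Set (Fin 2 → ℝ)} {y : Fin 2 → ℝ} {c : ℝ}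
    (h : ∀ x ∈ A, c ≤ ∑ i, x i * y i) : ∀ x ∈ convexHull ℝ A, c ≤ ∑ i, x i * y i := by
  intro x hx
  have hconv : Convex ℝ {x : Fin 2 → ℝ | c ≤ ∑ i, x i * y i} := by
    intro p hp q hq a b ha hb hab
    simp only [Set.mem_ofPred_eq, Fin.sum_univ_two, Pi.add_apply, Pi.smul_apply, smul_eq_mul] at *
    have : c = a * c + b * c := by rw [← add_mul, hab, one_mul]
    nlinarith [mul_le_mul_of_nonneg_left hp ha, mul_le_mul_of_nonneg_left hq hb]
  exact convexHull_min (show A ⊆ {x : Fin 2 → ℝ | c ≤ ∑ i, x i * y i} from h) hconv hx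

theorem sum_vec (p q : ℤ × ℤ) : ∑ i, vec p i * vec q i = (pr p q : ℝ) := by
  simp [Fin.sum_univ_two, pr]

theorem hull_eq {L W : List (ℤ × ℤ)} (h : Half L W) :
    hull L = {x | ∀ w ∈ W, -1 ≤ ∑ i, x i * vec w i} := by
  ext x
  constructor
  · intro hx w hw
    refine halfspace_hull ?_ x hx
    rintro _ ⟨p, hp, rfl⟩
    rw [sum_vec]
    rcases List.mem_cons.1 hp with rfl | hp
    · simp [pr]
    · exact_mod_cast h.2.1 p hp w hw
  · intro hx
    obtain ⟨i, hi, ha, hb⟩ := exists_cone h (x 0) (x 1)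
    obtain ⟨hD, w, hw, hw1, hw2⟩ := h.2.2.1 i hi
    have hxw := hx w hw
    have hp := nth_mem h.1 i
    have hq := nth_mem h.1 (i + 1)
    generalize nth L i = p at *
    generalize nth L (i + 1) = q at *
    have hD' : (p.1 : ℝ) * q.2 - p.2 * q.1 = 1 := by
      have := congrArg (Int.cast : ℤ → ℝ) hD
      simpa [dt] using this
    have hw1' : (p.1 : ℝ) * w.1 + p.2 * w.2 = -1 := by
      have := congrArg (Int.cast : ℤ → ℝ) hw1
      simpa [pr] using this
    have hw2' : (q.1 : ℝ) * w.1 + q.2 * w.2 = -1 := by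
      have := congrArg (Int.cast : ℤ → ℝ) hw2
      simpa [pr] using this
    have e0 : x 0 = (x 0 * q.2 - x 1 * q.1) * p.1 + (p.1 * x 1 - p.2 * x 0) * q.1 := by
      linear_combination (-x 0) * hD'
    have e1 : x 1 = (x 0 * q.2 - x 1 * q.1) * p.2 + (p.1 * x 1 - p.2 * x 0) * q.2 := by
      linear_combination (-x 1) * hD'
    have hsum : ∑ j, x j * vec w j = -((x 0 * q.2 - x 1 * q.1) + (p.1 * x 1 - p.2 * x 0)) := by
      simp only [Fin.sum_univ_two, vec_zero, vec_one]
      linear_combination (w.1 : ℝ) * e0 + (w.2 : ℝ) * e1 + (x 0 * q.2 - x 1 * q.1) * hw1' +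
        (p.1 * x 1 - p.2 * x 0) * hw2'
    rw [hsum] at hxw
    generalize x 0 * (q.2 : ℝ) - x 1 * q.1 = α at *
    generalize (p.1 : ℝ) * x 1 - p.2 * x 0 = β at *
    have mem : ∀ r : ℤ × ℤ, r ∈ (0, 0) :: L → vec r ∈ hull L := fun r hr =>
      subset_convexHull ℝ _ ⟨r, hr, rfl⟩
    have hc : Convex ℝ (hull L) := convex_convexHull ℝ _
    have key := hc.sum_mem (t := (Finset.univ : Finset (Fin 3))) (w := ![1 - α - β, α, β])
      (z := ![vec (0, 0), vec p, vec q]) (by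
        intro i _
        fin_cases i
        · simp; linarith
        · simpa using hb
        · simpa using ha) (by simp [Fin.sum_univ_three]; ring) (by
        intro i _
        fin_cases i
        · exact mem _ (by simp)
        · exact mem _ (by simp [hp])
        · exact mem _ (by simp [hq]))
    convert key using 1
    ext j
    fin_cases j
    · simp [Fin.sum_univ_three, e0]
    · simp [Fin.sum_univ_three, e1]

theorem lat_hull {L W : List (ℤ × ℤ)} (h : Half L W) : lat (hull L) = {p | p ∈ (0, 0) :: L} := by
  ext x
  constructor
  · intro hx
    have hx' : ∀ w ∈ W, -1 ≤ pr x w := by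
      intro w hw
      have h1 : vec x ∈ hull L := hx
      rw [hull_eq h] at h1
      have := h1 w hw
      rw [sum_vec] at this
      exact_mod_cast this
    obtain ⟨i, hi, ha, hb⟩ := exists_cone h x.1 x.2
    obtain ⟨hD, w, hw, hw1, hw2⟩ := h.2.2.1 i hi
    have hxw := hx' w hw
    have hp := nth_mem h.1 i
    have hq := nth_mem h.1 (i + 1)
    generalize nth L i = p at *
    generalize nth L (i + 1) = q at *
    have ha' : 0 ≤ p.1 * x.2 - p.2 * x.1 := by exact_mod_cast ha
    have hb' : 0 ≤ x.1 * q.2 - x.2 * q.1 := by exact_mod_cast hb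
    simp only [dt, pr] at hD hw1 hw2 hxw
    have e0 : x.1 = (x.1 * q.2 - x.2 * q.1) * p.1 + (p.1 * x.2 - p.2 * x.1) * q.1 := by
      linear_combination (-x.1) * hD
    have e1 : x.2 = (x.1 * q.2 - x.2 * q.1) * p.2 + (p.1 * x.2 - p.2 * x.1) * q.2 := by
      linear_combination (-x.2) * hD
    have hsum : x.1 * w.1 + x.2 * w.2 =
        -((x.1 * q.2 - x.2 * q.1) + (p.1 * x.2 - p.2 * x.1)) := by
      linear_combination w.1 * e0 + w.2 * e1 + (x.1 * q.2 - x.2 * q.1) * hw1 +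
        (p.1 * x.2 - p.2 * x.1) * hw2
    rw [hsum] at hxw
    generalize x.1 * q.2 - x.2 * q.1 = α at *
    generalize p.1 * x.2 - p.2 * x.1 = β at *
    have : (α = 0 ∧ β = 0) ∨ (α = 1 ∧ β = 0) ∨ (α = 0 ∧ β = 1) := by omega
    simp only [Set.mem_ofPred_eq, List.mem_cons]
    rcases this with ⟨rfl, rfl⟩ | ⟨rfl, rfl⟩ | ⟨rfl, rfl⟩
    · left; ext <;> simp [e0, e1]
    · right
      have : x = p := by ext <;> simp [e0, e1]
      rwa [this]
    · right
      have : x = q := by ext <;> simp [e0, e1]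
      rwa [this]
  · intro hx
    exact subset_convexHull ℝ _ ⟨x, hx, rfl⟩

theorem exists_push {P : Set (Fin 2 → ℝ)} {z : Fin 2 → ℝ} (hz : z ∈ interior P) (v : Fin 2 → ℝ) :
    ∃ c : ℝ, 0 < c ∧ z + c • v ∈ P := by
  have hcont : Continuous (fun c : ℝ => z + c • v) := by fun_prop
  have h0 : (fun c : ℝ => z + c • v) ⁻¹' (interior P) ∈ nhds (0 : ℝ) :=
    (isOpen_interior.preimage hcont).mem_nhds (by simpa using hz)
  obtain ⟨ε, hε, hb⟩ := Metric.mem_nhds_iff.1 h0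
  refine ⟨ε / 2, by positivity, interior_subset (hb ?_)⟩
  simp [abs_of_pos hε, hε]

theorem open_slab (W : Set (ℤ × ℤ)) (hW : W.Finite) :
    IsOpen {x : Fin 2 → ℝ | ∀ w ∈ W, -1 < ∑ i, x i * vec w i} := by
  have : {x : Fin 2 → ℝ | ∀ w ∈ W, -1 < ∑ i, x i * vec w i} =
      ⋂ w ∈ W, {x : Fin 2 → ℝ | -1 < ∑ i, x i * vec w i} := by ext; simp
  rw [this]
  refine hW.isOpen_biInter fun w _ => isOpen_lt continuous_const ?_
  fun_prop

theorem hull_reflexive {L W : List (ℤ × ℤ)} (h : Half L W) (h' : Half W L) :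
    IsReflexivePolytope (hull L) := by
  have hsub : {x : Fin 2 → ℝ | ∀ w ∈ {w | w ∈ W}, -1 < ∑ i, x i * vec w i} ⊆ interior (hull L) := by
    apply interior_maximal
    · rw [hull_eq h]
      intro x hx w hw
      exact (hx w hw).le
    · exact open_slab _ (List.finite_toSet W)
  have h0 : castVec (0 : Fin 2 → ℤ) ∈ interior (hull L) := by
    apply hsub
    intro w _
    simp [castVec]
  refine ⟨hull_lattice L, ⟨_, h0⟩, ?_, ?_⟩
  · intro v
    refine ⟨fun hv => ?_, fun hv => hv ▸ h0⟩
    obtain ⟨c, hc, hcv⟩ := exists_push hv (castVec v)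
    rw [hull_eq h] at hcv
    have hnn : ∀ w ∈ W, 0 ≤ v 0 * w.1 + v 1 * w.2 := by
      intro w hw
      have := hcv w hw
      simp only [Fin.sum_univ_two, Pi.add_apply, Pi.smul_apply, smul_eq_mul, castVec, vec_zero,
        vec_one] at this
      have h2 : -1 ≤ (1 + c) * ((v 0 : ℝ) * w.1 + v 1 * w.2) := by linarith
      by_contra hneg
      have h3 : v 0 * w.1 + v 1 * w.2 ≤ -1 := by omega
      have h4 : (v 0 : ℝ) * w.1 + v 1 * w.2 ≤ -1 := by exact_mod_cast h3
      nlinarith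
    have hg : ∀ g ∈ [((1 : ℤ), (0 : ℤ)), (-1, 0), (0, 1), (0, -1)],
        0 ≤ v 0 * g.1 + v 1 * g.2 := by
      intro g hg
      obtain ⟨j, hj, a1, a2⟩ := h'.2.2.2 g hg
      have hD := (h'.2.2.1 j hj).1
      have n1 := hnn _ (nth_mem h'.1 j)
      have n2 := hnn _ (nth_mem h'.1 (j + 1))
      generalize nth W j = p at *
      generalize nth W (j + 1) = q at *
      have : v 0 * g.1 + v 1 * g.2 =
          dt g q * (v 0 * p.1 + v 1 * p.2) + dt p g * (v 0 * q.1 + v 1 * q.2) := by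
        simp only [dt] at *
        linear_combination (-(v 0 * g.1 + v 1 * g.2)) * hD
      rw [this]
      positivity
    have e1 := hg (1, 0) (by decide)
    have e2 := hg (-1, 0) (by decide)
    have e3 := hg (0, 1) (by decide)
    have e4 := hg (0, -1) (by decide)
    simp at e1 e2 e3 e4
    ext j
    fin_cases j
    · simp; omega
    · simp; omega
  · have : {y : Fin 2 → ℝ | ∀ x ∈ hull L, (-1 : ℝ) ≤ ∑ i, x i * y i} = hull W := by
      rw [hull_eq h']
      ext y
      constructor
      · intro hy p hp
        have := hy (vec p) (subset_convexHull ℝ _ ⟨p, List.mem_cons_of_mem _ hp, rfl⟩)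
        simpa only [mul_comm] using this
      · intro hy
        refine halfspace_hull ?_
        rintro _ ⟨p, hp, rfl⟩
        rcases List.mem_cons.1 hp with rfl | hp
        · simp
        · simpa only [mul_comm] using hy p hp
    rw [this]
    exact hull_lattice W
/-- Dual polygon. -/
def dualSet (P : Set (Fin 2 → ℝ)) : Set (Fin 2 → ℝ) :=
  {y : Fin 2 → ℝ | ∀ x ∈ P, (-1 : ℝ) ≤ ∑ i, x i * y i}

theorem bipolar {P : Set (Fin 2 → ℝ)} (hc : Convex ℝ P) (hcl : IsClosed P) (h0 : (0 : Fin 2 → ℝ) ∈ P)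
    (x : Fin 2 → ℝ) (hx : ∀ y ∈ dualSet P, (-1 : ℝ) ≤ ∑ i, x i * y i) : x ∈ P := by
  by_contra hxP
  obtain ⟨f, u, h1, h2⟩ := geometric_hahn_banach_point_closed hc hcl hxP
  have hu : u < 0 := by simpa using h2 0 h0
  have hf : ∀ z : Fin 2 → ℝ, f z = z 0 * f (Pi.single 0 1) + z 1 * f (Pi.single 1 1) := by
    intro z
    have : z = z 0 • (Pi.single 0 1 : Fin 2 → ℝ) + z 1 • (Pi.single 1 1 : Fin 2 → ℝ) := by
      ext j; fin_cases j <;> simp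
    conv_lhs => rw [this]
    simp
  have hs : ∀ z : Fin 2 → ℝ, ∑ i, z i * (![f (Pi.single 0 1) / (-u), f (Pi.single 1 1) / (-u)] :
      Fin 2 → ℝ) i = f z / (-u) := by
    intro z
    rw [hf z]
    simp [Fin.sum_univ_two]
    ring
  have := hx ![f (Pi.single 0 1) / (-u), f (Pi.single 1 1) / (-u)] (by
    intro z hz
    rw [hs, le_div_iff₀ (by linarith)]
    have := h2 z hz
    linarith)
  rw [hs, le_div_iff₀ (by linarith)] at this
  linarith

theorem lattice_hull {P : Set (Fin 2 → ℝ)} (h : IsLatticePolytope P) :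
    P = convexHull ℝ (vec '' lat P) ∧ IsClosed P ∧ Convex ℝ P ∧
    ∃ F : Set (ℤ × ℤ), F.Finite ∧ P = convexHull ℝ (vec '' F) := by
  obtain ⟨F, hF⟩ := h
  have hconv : Convex ℝ P := by rw [hF]; exact convex_convexHull ℝ _
  have hset : castVec '' (F : Set (Fin 2 → ℤ)) = vec '' (zvec ⁻¹' (F : Set (Fin 2 → ℤ))) := by
    ext x
    constructor
    · rintro ⟨v, hv, rfl⟩
      exact ⟨(v 0, v 1), by simpa [zvec_surj] using hv, by rw [vec, zvec_surj]⟩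
    · rintro ⟨p, hp, rfl⟩
      exact ⟨zvec p, hp, rfl⟩
  have hinj : Function.Injective zvec := by
    intro p q hpq
    ext
    · exact congrFun hpq 0
    · exact congrFun hpq 1
  refine ⟨?_, ?_, hconv, _, F.finite_toSet.preimage hinj.injOn, by rw [hF, hset]⟩
  · apply Set.Subset.antisymm
    · conv_lhs => rw [hF, hset]
      apply convexHull_mono
      apply Set.image_mono
      intro p hp
      have : vec p ∈ convexHull ℝ (castVec '' (F : Set (Fin 2 → ℤ))) :=
        subset_convexHull ℝ _ ⟨zvec p, hp, rfl⟩
      rw [← hF] at this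
      exact this
    · apply convexHull_min _ hconv
      rintro _ ⟨p, hp, rfl⟩
      exact hp
  · rw [hF]
    exact (F.finite_toSet.image _).isClosed_convexHull ℝ

theorem polarPair {P : Set (Fin 2 → ℝ)} (h : IsReflexivePolytope P) :
    PolarPair (lat P) (lat (dualSet P)) := by
  obtain ⟨hP, -, hint, hD⟩ := h
  obtain ⟨hP1, hPcl, hPc, -⟩ := lattice_hull hP
  obtain ⟨-, -, -, G, hG, hDG⟩ := lattice_hull (P := dualSet P) hD
  have h0i : (0 : Fin 2 → ℝ) ∈ interior P := by
    have := (hint 0).2 rfl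
    have e : castVec (0 : Fin 2 → ℤ) = 0 := by ext; simp [castVec]
    rwa [e] at this
  have h0 := interior_subset h0i
  have hGmem : ∀ g ∈ G, g ∈ lat (dualSet P) := by
    intro g hg
    change vec g ∈ dualSet P
    rw [hDG]
    exact subset_convexHull ℝ _ ⟨g, hg, rfl⟩
  have hPG : ∀ x : Fin 2 → ℝ, (∀ g ∈ G, -1 ≤ ∑ i, x i * vec g i) → x ∈ P := by
    intro x hx
    refine bipolar hPc hPcl h0 x ?_
    intro y hy
    rw [hDG] at hy
    have := halfspace_hull (A := vec '' G) (y := x) (c := -1) (by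
      rintro _ ⟨g, hg, rfl⟩
      simpa only [mul_comm] using hx g hg) y hy
    simpa only [mul_comm] using this
  refine ⟨?_, ?_, ?_, ?_⟩
  · intro s
    constructor
    · intro hs t ht
      have : (-1 : ℝ) ≤ ∑ i, vec s i * vec t i := ht _ hs
      rw [sum_vec] at this
      exact_mod_cast this
    · intro hs
      refine hPG _ ?_
      intro g hg
      rw [sum_vec]
      exact_mod_cast hs g (hGmem g hg)
  · intro t
    constructor
    · intro ht s hs
      have : (-1 : ℝ) ≤ ∑ i, vec s i * vec t i := ht _ hs
      rw [sum_vec] at this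
      exact_mod_cast this
    · intro ht x hx
      rw [hP1] at hx
      refine halfspace_hull ?_ x hx
      rintro _ ⟨s, hs, rfl⟩
      rw [sum_vec]
      exact_mod_cast ht s hs
  · intro t ht
    by_contra hc
    push Not at hc
    have hall : ∀ x ∈ P, 0 ≤ ∑ i, x i * vec t i := by
      intro x hx
      rw [hP1] at hx
      refine halfspace_hull ?_ x hx
      rintro _ ⟨s, hs, rfl⟩
      rw [sum_vec]
      exact_mod_cast hc s hs
    obtain ⟨c, hc0, hcP⟩ := exists_push h0i (-vec t)
    have := hall _ hcP
    simp [Fin.sum_univ_two] at this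
    have h3 : 0 ≤ -(c * ((t.1 : ℝ) ^ 2 + (t.2 : ℝ) ^ 2)) := by linarith
    have h4 : (t.1 : ℝ) ^ 2 + (t.2 : ℝ) ^ 2 ≤ 0 := by
      by_contra h5
      push Not at h5
      have := mul_pos hc0 h5
      linarith
    apply ht
    have h5 : t.1 ^ 2 + t.2 ^ 2 ≤ 0 := by exact_mod_cast h4
    ext
    · simp; nlinarith [sq_nonneg t.1, sq_nonneg t.2]
    · simp; nlinarith [sq_nonneg t.1, sq_nonneg t.2]
  · intro s hs
    by_contra hc
    push Not at hc
    have hsi : vec s ∈ interior P := by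
      have hsub : {x : Fin 2 → ℝ | ∀ w ∈ G, -1 < ∑ i, x i * vec w i} ⊆ interior P := by
        apply interior_maximal
        · intro x hx
          exact hPG x fun g hg => (hx g hg).le
        · exact open_slab _ hG
      apply hsub
      intro g hg
      rw [sum_vec]
      have := hc g (hGmem g hg)
      have : -1 < pr s g := by omega
      exact_mod_cast this
    have := (hint (zvec s)).1 hsi
    apply hs
    ext
    · exact congrFun this 0
    · exact congrFun this 1

theorem mulVec_vec (A : Matrix (Fin 2) (Fin 2) ℤ) (p : ℤ × ℤ) :
    (A.map (fun k : ℤ => (k : ℝ))).mulVec (vec p) =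
      vec (ap (A 0 0, A 0 1, A 1 0, A 1 1) p) := by
  ext i
  fin_cases i <;> simp [Matrix.mulVec, dotProduct, Fin.sum_univ_two, ap]

theorem image_hull (A : Matrix (Fin 2) (Fin 2) ℤ) (S : Set (ℤ × ℤ)) :
    (fun x => (A.map (fun k : ℤ => (k : ℝ))).mulVec x) '' convexHull ℝ (vec '' S) =
      convexHull ℝ (vec '' (ap (A 0 0, A 0 1, A 1 0, A 1 1) '' S)) := by
  have := (Matrix.mulVecLin (A.map (fun k : ℤ => (k : ℝ)))).image_convexHull (vec '' S)
  have e : ⇑(Matrix.mulVecLin (A.map (fun k : ℤ => (k : ℝ)))) =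
      fun x => (A.map (fun k : ℤ => (k : ℝ))).mulVec x := by
    ext x; simp
  rw [e] at this
  rw [this, Set.image_image, Set.image_image]
  simp only [mulVec_vec]

theorem equiv_exists {P : Set (Fin 2 → ℝ)} (h : IsReflexivePolytope P) :
    ∃ L ∈ polys, UnimodularEquiv P (hull L.1) := by
  obtain ⟨g, hg, L, hL, himg⟩ := classify (polarPair h)
  refine ⟨L, hL, !![g.1, g.2.1; g.2.2.1, g.2.2.2], ?_, ?_⟩
  · rw [Matrix.det_fin_two_of]
    exact IsUnit.of_mul_eq_one _ hg
  · rw [(lattice_hull h.1).1, image_hull]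
    unfold hull
    rw [← himg]
    rfl

/-- Number of pairs of lattice points with a given determinant up to sign. -/
noncomputable def inv (P : Set (Fin 2 → ℝ)) (k : ℕ) : ℕ :=
  Set.ncard {x : (ℤ × ℤ) × (ℤ × ℤ) | x.1 ∈ lat P ∧ x.2 ∈ lat P ∧ (dt x.1 x.2).natAbs = k}

theorem inv_equiv {P Q : Set (Fin 2 → ℝ)} (h : UnimodularEquiv P Q) (k : ℕ) :
    inv P k = inv Q k := by
  obtain ⟨A, hA, rfl⟩ := h
  rw [Matrix.det_fin_two] at hA
  have hdd := Int.isUnit_mul_self hA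
  have habs := Int.natAbs_of_isUnit hA
  set g : ℤ × ℤ × ℤ × ℤ := (A 0 0, A 0 1, A 1 0, A 1 1) with hg
  have hlin : ∀ x y : Fin 2 → ℝ, (A.map (fun k : ℤ => (k : ℝ))).mulVec x =
      (A.map (fun k : ℤ => (k : ℝ))).mulVec y → x = y := by
    intro x y hxy
    have c0 := congrFun hxy 0
    have c1 := congrFun hxy 1
    simp [Matrix.mulVec, dotProduct, Fin.sum_univ_two] at c0 c1
    have hdr : ((A 0 0 : ℝ) * A 1 1 - A 0 1 * A 1 0) * (A 0 0 * A 1 1 - A 0 1 * A 1 0) = 1 := by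
      exact_mod_cast hdd
    ext j
    fin_cases j
    · simp only [Fin.zero_eta]
      linear_combination (-(x 0 - y 0)) * hdr +
        ((A 0 0 : ℝ) * A 1 1 - A 0 1 * A 1 0) * (A 1 1 * c0 - A 0 1 * c1)
    · simp only [Fin.mk_one]
      linear_combination (-(x 1 - y 1)) * hdr +
        ((A 0 0 : ℝ) * A 1 1 - A 0 1 * A 1 0) * (A 0 0 * c1 - A 1 0 * c0)
  have hvinj : Function.Injective vec := by
    intro p q hpq
    have c0 := congrFun hpq 0
    have c1 := congrFun hpq 1
    simp at c0 c1
    exact Prod.ext c0 c1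
  have hinj : Function.Injective (ap g) := by
    intro p q hpq
    apply hvinj
    apply hlin
    rw [mulVec_vec, mulVec_vec, hpq]
  have hsurj : ∀ q, ∃ p, ap g p = q := by
    intro y
    refine ⟨((A 0 0 * A 1 1 - A 0 1 * A 1 0) * (A 1 1 * y.1 - A 0 1 * y.2),
      (A 0 0 * A 1 1 - A 0 1 * A 1 0) * (A 0 0 * y.2 - A 1 0 * y.1)), ?_⟩
    simp only [ap, g]
    ext
    · simp only; linear_combination y.1 * hdd
    · simp only; linear_combination y.2 * hdd
  have hmem : ∀ p, ap g p ∈ lat ((fun x => (A.map (fun k : ℤ => (k : ℝ))).mulVec x) '' P) ↔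
      p ∈ lat P := by
    intro p
    constructor
    · rintro ⟨x, hx, hxp⟩
      simp only at hxp
      rw [← mulVec_vec] at hxp
      have := hlin _ _ hxp
      change vec p ∈ P
      rwa [← this]
    · intro hp
      exact ⟨vec p, hp, mulVec_vec A p⟩
  have hdt : ∀ p q, (dt (ap g p) (ap g q)).natAbs = (dt p q).natAbs := by
    intro p q
    have : dt (ap g p) (ap g q) = (A 0 0 * A 1 1 - A 0 1 * A 1 0) * dt p q := by
      simp only [dt, ap, g]; ring
    rw [this, Int.natAbs_mul, habs, one_mul]
  unfold inv
  rw [← Set.ncard_image_of_injective _ (hinj.prodMap hinj)]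
  congr 1
  ext ⟨a, b⟩
  obtain ⟨p, rfl⟩ := hsurj a
  obtain ⟨q, rfl⟩ := hsurj b
  constructor
  · rintro ⟨⟨p', q'⟩, ⟨h1, h2, h3⟩, h4⟩
    simp only [Prod.map_apply, Prod.mk.injEq] at h4
    have e1 := hinj h4.1
    have e2 := hinj h4.2
    subst e1 e2
    exact ⟨(hmem _).2 h1, (hmem _).2 h2, by simpa only [hdt] using h3⟩
  · rintro ⟨h1, h2, h3⟩
    refine ⟨(p, q), ⟨(hmem _).1 h1, (hmem _).1 h2, ?_⟩, rfl⟩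
    simpa only [hdt] using h3

/-- Computable version of the invariant. -/
def cnt (L : List (ℤ × ℤ)) (k : ℕ) : ℕ :=
  ((((0, 0) :: L) ×ˢ ((0, 0) :: L)).filter (fun x => (dt x.1 x.2).natAbs == k)).length

theorem inv_hull {L W : List (ℤ × ℤ)} (h : Half L W) (hn : ((0, 0) :: L).Nodup) (k : ℕ) :
    inv (hull L) k = cnt L k := by
  classical
  unfold inv cnt
  rw [lat_hull h]
  have hnd : ((((0, 0) :: L) ×ˢ ((0, 0) :: L)).filter
      (fun x => (dt x.1 x.2).natAbs == k)).Nodup := (hn.product hn).filter _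
  rw [← List.toFinset_card_of_nodup hnd, ← Set.ncard_coe_finset]
  congr 1
  ext ⟨a, b⟩
  simp only [Set.mem_ofPred_eq, List.coe_toFinset, List.mem_filter, beq_iff_eq]
  have := List.pair_mem_product (xs := (0, 0) :: L) (ys := (0, 0) :: L) (x := a) (y := b)
  rw [← and_assoc]
  exact and_congr_left fun _ => this.symm

theorem polys_nodup : ∀ L ∈ polys, ((0, 0) :: L.1).Nodup := by decide +kernel

theorem polys_length : polys.length = 16 := rfl

theorem polys_inj : ∀ i j : Fin 16, cnt (polys.get i).1 0 = cnt (polys.get j).1 0 →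
    cnt (polys.get i).1 1 = cnt (polys.get j).1 1 → i = j := by decide +kernel

/-- There are exactly 16 reflexive polygons up to unimodular equivalence. -/
theorem reflexive_polygons_card_sixteen :
    Nat.card (Quot (fun P Q : {P : Set (Fin 2 → ℝ) // IsReflexivePolytope P} =>
      UnimodularEquiv P.1 Q.1)) = 16 := by
  let r : {P : Set (Fin 2 → ℝ) // IsReflexivePolytope P} →
      {P : Set (Fin 2 → ℝ) // IsReflexivePolytope P} → Prop := fun P Q => UnimodularEquiv P.1 Q.1
  have hh : ∀ i : Fin 16, Half (polys.get i).1 (polys.get i).2 ∧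
      Half (polys.get i).2 (polys.get i).1 := fun i => polys_half _ (List.get_mem _ _)
  let F : Fin 16 → Quot r := fun i =>
    Quot.mk r ⟨hull (polys.get i).1, hull_reflexive (hh i).1 (hh i).2⟩
  have hF : Function.Bijective F := by
    constructor
    · intro i j hij
      let I : ℕ → Quot r → ℕ := fun k => Quot.lift (fun P => inv P.1 k)
        (fun P Q h => inv_equiv h k)
      have key : ∀ k, cnt (polys.get i).1 k = cnt (polys.get j).1 k := by
        intro k
        have h1 : I k (F i) = I k (F j) := congrArg (I k) hij
        change inv (hull (polys.get i).1) k = inv (hull (polys.get j).1) k at h1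
        rwa [inv_hull (hh i).1 (polys_nodup _ (List.get_mem _ _)),
          inv_hull (hh j).1 (polys_nodup _ (List.get_mem _ _))] at h1
      exact polys_inj i j (key 0) (key 1)
    · intro q
      induction q using Quot.ind with
      | mk P =>
        obtain ⟨L, hL, heq⟩ := equiv_exists P.2
        obtain ⟨i, rfl⟩ := List.mem_iff_get.1 hL
        refine ⟨i, Eq.symm ?_⟩
        exact Quot.sound (r := r) (b := ⟨hull (polys.get i).1, hull_reflexive (hh i).1 (hh i).2⟩) heq
  have := Nat.card_eq_of_bijective F hF
  rw [Nat.card_eq_fintype_card, Fintype.card_fin] at this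
  exact this.symm
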